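/- Fix integers q ≥ 1 and 0 ≤ r < s, and let e_k^− = E_k((x+r)/q) − E_k((x+s)/q). Then for all m ≥ 0, H_{2m}(e_k^−) = 0 and H_{2m+1}(e_k^−) = (−1)^{m+1} ((s−r)/q)^{2m+2} · Π_{ℓ=1}^{m} ( (ℓ^2/4)(((s−r)/q)^2 − (2ℓ)^2) )^{2(m+1−ℓ)}. -/

import Mathlib

/-- The `n`-th Hankel determinant of a sequence `c`. -/
noncomputable def hankel {R : Type*} [CommRing R] (c : ℕ → R) (n : ℕ) : R :=
  (Matrix.of fun i j : Fin (n + 1) => c (i.1 + j.1)).det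

/-- The `n`-th Euler polynomial, evaluated at `x`, via
`E_n(x) = (2/(n+1)) (B_{n+1}(x) - 2^{n+1} B_{n+1}(x/2))`. -/
noncomputable def eulerPoly (n : ℕ) (x : ℚ) : ℚ :=
  (2 / (n + 1)) *
    ((Polynomial.bernoulli (n + 1)).eval x - 2 ^ (n + 1) * (Polynomial.bernoulli (n + 1)).eval (x / 2))

open Polynomial in
/-- Exponential generating function of the Euler polynomials at `x`. -/
theorem eulerPoly_generating_function (x : ℚ) :
    (PowerSeries.mk fun n => eulerPoly n x / (n.factorial : ℚ)) * (PowerSeries.exp ℚ + 1) =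
      2 * PowerSeries.rescale x (PowerSeries.exp ℚ) := by
  set e := PowerSeries.exp ℚ with he
  set G : ℚ → PowerSeries ℚ := fun t =>
    PowerSeries.mk fun n => aeval t ((1 / n.factorial : ℚ) • Polynomial.bernoulli n) with hG
  have hB : ∀ t, G t * (e - 1) = PowerSeries.X * PowerSeries.rescale t e :=
    bernoulli_generating_function
  have hX : (PowerSeries.mk fun n => eulerPoly n x / (n.factorial : ℚ)) * PowerSeries.X =
      2 * (G x - PowerSeries.rescale 2 (G (x / 2))) := by
    have h2 : (2 : PowerSeries ℚ) = PowerSeries.C 2 := (map_ofNat PowerSeries.C 2).symm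
    ext n
    cases n with
    | zero =>
      rw [h2, PowerSeries.coeff_C_mul, map_sub, PowerSeries.coeff_rescale]
      simp [hG]
    | succ n =>
      rw [PowerSeries.coeff_succ_mul_X, h2, PowerSeries.coeff_C_mul]
      simp only [hG, map_sub, PowerSeries.coeff_rescale, PowerSeries.coeff_mk, eulerPoly,
        map_smul, smul_eq_mul, coe_aeval_eq_eval, Nat.factorial_succ]
      push_cast
      field_simp
  have hsq : PowerSeries.rescale 2 e = e ^ 2 := by
    have := PowerSeries.exp_pow_eq_rescale_exp (A := ℚ) 2
    rw [this]; norm_num [he]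
  have hC : PowerSeries.C (2 : ℚ) = 2 := map_ofNat PowerSeries.C 2
  have hB2 : PowerSeries.rescale 2 (G (x / 2)) * (e ^ 2 - 1) =
      2 * PowerSeries.X * PowerSeries.rescale x e := by
    have := congrArg (PowerSeries.rescale (2 : ℚ)) (hB (x / 2))
    rw [map_mul, map_mul, map_sub, hsq, map_one, PowerSeries.rescale_X,
      PowerSeries.rescale_rescale, hC] at this
    rw [this]; congr 4; ring
  have hne : PowerSeries.X * (e - 1) ≠ 0 := by
    refine mul_ne_zero PowerSeries.X_ne_zero fun h => ?_
    have := congrArg (PowerSeries.coeff 1) h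
    simp [he, PowerSeries.coeff_exp, PowerSeries.coeff_one] at this
  apply mul_right_cancel₀ hne
  linear_combination (e + 1) * (e - 1) * hX + 2 * (e + 1) * hB x - 2 * hB2

theorem sum_choose_mul_eulerPoly (x : ℚ) (n : ℕ) :
    ∑ k ∈ Finset.range (n + 1), (n.choose k : ℚ) * eulerPoly k x + eulerPoly n x = 2 * x ^ n := by
  have h := congrArg (PowerSeries.coeff n) (eulerPoly_generating_function x)
  have h2 : (2 : PowerSeries ℚ) = PowerSeries.C 2 := (map_ofNat PowerSeries.C 2).symm
  rw [mul_add, mul_one, map_add, PowerSeries.coeff_mul,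
    Finset.Nat.sum_antidiagonal_eq_sum_range_succ_mk, h2, PowerSeries.coeff_C_mul,
    PowerSeries.coeff_rescale] at h
  simp only [PowerSeries.coeff_mk, PowerSeries.coeff_exp, Algebra.algebraMap_self_apply] at h
  have hn : (n.factorial : ℚ) ≠ 0 := Nat.cast_ne_zero.2 n.factorial_ne_zero
  have hs : ∑ k ∈ Finset.range (n + 1), (n.choose k : ℚ) * eulerPoly k x =
      n.factorial * ∑ k ∈ Finset.range (n + 1),
        eulerPoly k x / k.factorial * (1 / (n - k).factorial) := by
    rw [Finset.mul_sum]
    refine Finset.sum_congr rfl fun k hk => ?_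
    rw [Nat.cast_choose ℚ (Nat.lt_succ_iff.1 (Finset.mem_range.1 hk))]
    field_simp
  rw [hs]
  field_simp at h ⊢
  linear_combination h

open Polynomial

/-- The linear functional on `ℚ[X]` with moments `c`. -/
noncomputable def momentFunctional (c : ℕ → ℚ) : ℚ[X] →ₗ[ℚ] ℚ :=
  (basisMonomials ℚ).constr ℚ c

theorem momentFunctional_X_pow (c : ℕ → ℚ) (n : ℕ) : momentFunctional c (X ^ n) = c n := by
  have := (basisMonomials ℚ).constr_basis ℚ c n
  simpa only [momentFunctional, coe_basisMonomials, monomial_one_right_eq_X_pow] using this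

theorem linearMap_ext_X_pow {Φ Ψ : ℚ[X] →ₗ[ℚ] ℚ} (h : ∀ n, Φ (X ^ n) = Ψ (X ^ n)) : Φ = Ψ := by
  refine (basisMonomials ℚ).ext fun n => ?_
  simpa only [coe_basisMonomials, monomial_one_right_eq_X_pow] using h n

theorem momentFunctional_eulerPoly (y : ℚ) (f : ℚ[X]) :
    momentFunctional (fun k => eulerPoly k y) (f.comp (X + 1) + f) = 2 * f.eval y := by
  set Λ := momentFunctional (fun k => eulerPoly k y) with hΛ
  suffices Λ ∘ₗ ((aeval (X + 1 : ℚ[X])).toLinearMap + LinearMap.id) =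
      (2 : ℚ) • (aeval y : ℚ[X] →ₐ[ℚ] ℚ).toLinearMap by
    simpa [← comp_eq_aeval, ← coe_aeval_eq_eval] using LinearMap.congr_fun this f
  refine linearMap_ext_X_pow fun n => ?_
  have := sum_choose_mul_eulerPoly y n
  simp only [LinearMap.comp_apply, LinearMap.add_apply, LinearMap.id_apply, map_add,
    LinearMap.smul_apply, AlgHom.toLinearMap_apply, map_pow, aeval_X, smul_eq_mul]
  rw [← this, add_pow, map_sum, hΛ, momentFunctional_X_pow]
  congr 1
  refine Finset.sum_congr rfl fun k _ => ?_
  rw [one_pow, mul_one, mul_comm, ← C_eq_natCast, ← smul_eq_C_mul, map_smul,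
    momentFunctional_X_pow, smul_eq_mul]

/-- A functional annihilating all `f(X + 1) + f(X)` vanishes. -/
theorem eq_zero_of_comp_X_add_one (Θ : ℚ[X] →ₗ[ℚ] ℚ)
    (h : ∀ f : ℚ[X], Θ (f.comp (X + 1) + f) = 0) : Θ = 0 := by
  refine linearMap_ext_X_pow fun n => ?_
  induction n using Nat.strong_induction_on with
  | _ n ih =>
    have := h (X ^ n)
    rw [X_pow_comp, add_pow, map_add, map_sum, Finset.sum_range_succ,
      Finset.sum_eq_zero] at this
    · simp at this ⊢
      linarith
    · intro k hk
      rw [one_pow, mul_one, mul_comm, ← C_eq_natCast, ← smul_eq_C_mul, map_smul,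
        ih k (Finset.mem_range.1 hk)]
      simp

theorem det_monic_eq_hankel (Φ : ℚ[X] →ₗ[ℚ] ℚ) (n : ℕ) (P Q : ℕ → ℚ[X])
    (hP : ∀ i, (P i).Monic) (hP' : ∀ i, (P i).natDegree = i)
    (hQ : ∀ i, (Q i).Monic) (hQ' : ∀ i, (Q i).natDegree = i) :
    (Matrix.of fun i j : Fin (n + 1) => Φ (P i * Q j)).det = hankel (fun k => Φ (X ^ k)) n := by
  set p := Matrix.of fun i j : Fin (n + 1) => (P j).coeff i
  set q := Matrix.of fun i j : Fin (n + 1) => (Q j).coeff i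
  have hp : p.det = 1 := Matrix.det_matrixOfPolynomials (fun i : Fin (n + 1) => P i)
    (fun i => hP' i) fun i => hP i
  have hq : q.det = 1 := Matrix.det_matrixOfPolynomials (fun i : Fin (n + 1) => Q i)
    (fun i => hQ' i) fun i => hQ i
  have hexp : ∀ R : ℕ → ℚ[X], (∀ i, (R i).natDegree = i) → ∀ i : Fin (n + 1),
      R i = ∑ k : Fin (n + 1), (R i).coeff k • X ^ (k : ℕ) := by
    intro R hR i
    rw [Fin.sum_univ_eq_sum_range (fun k => (R i).coeff k • X ^ k)]
    conv_lhs => rw [(R i).as_sum_range' (n + 1) (by rw [hR]; exact i.2)]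
    simp [smul_X_eq_monomial]
  have : (Matrix.of fun i j : Fin (n + 1) => Φ (P i * Q j)) =
      p.transpose * (Matrix.of fun i j : Fin (n + 1) => Φ (X ^ (i.1 + j.1))) * q := by
    ext i j
    simp only [Matrix.of_apply, Matrix.mul_apply, Matrix.transpose_apply, p, q]
    conv_lhs => rw [hexp P hP' i, hexp Q hQ' j]
    rw [Finset.sum_mul_sum]
    simp only [map_sum, Finset.sum_mul]
    rw [Finset.sum_comm]
    refine Finset.sum_congr rfl fun k _ => Finset.sum_congr rfl fun l _ => ?_
    rw [smul_mul_smul_comm, ← pow_add, map_smul, smul_eq_mul]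
    ring
  rw [this, Matrix.det_mul, Matrix.det_mul, Matrix.det_transpose, hp, hq, hankel]
  ring

/-- `Φ` sends `g(X + 1/2) + g(X - 1/2)` to `2 (g(-d/2) - g(d/2))`, i.e. `Φ` is the difference of
two Euler functionals, centred at the midpoint of their nodes, which are `d` apart. -/
def IsEulerDifference (Φ : ℚ[X] →ₗ[ℚ] ℚ) (d : ℚ) : Prop :=
  ∀ g : ℚ[X], Φ (g.comp (X + C (1 / 2)) + g.comp (X - C (1 / 2))) =
    2 * (g.eval (-d / 2) - g.eval (d / 2))

/-- `∏_{i < k} (X² - (a + i)²)`. -/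
noncomputable def sqProd (a : ℚ) (k : ℕ) : ℚ[X] :=
  ∏ i ∈ Finset.range k, (X ^ 2 - C ((a + i) ^ 2))

theorem sqProd_succ (a : ℚ) (k : ℕ) :
    sqProd a (k + 1) = sqProd a k * (X ^ 2 - C ((a + k) ^ 2)) :=
  Finset.prod_range_succ _ _

theorem monic_sqProd (a : ℚ) (k : ℕ) : (sqProd a k).Monic :=
  monic_prod_of_monic _ _ fun _ _ => monic_X_pow_sub_C _ two_ne_zero

theorem natDegree_sqProd (a : ℚ) (k : ℕ) : (sqProd a k).natDegree = 2 * k := by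
  rw [sqProd, natDegree_prod_of_monic _ _ fun _ _ => monic_X_pow_sub_C _ two_ne_zero]
  simp only [natDegree_X_pow_sub_C, Finset.sum_const, Finset.card_range, smul_eq_mul]
  ring

theorem sqProd_comp_neg_X (a : ℚ) (k : ℕ) : (sqProd a k).comp (-X) = sqProd a k := by
  simp [sqProd, prod_comp]

theorem sqProd_comp_X_add_half (d : ℚ) (k : ℕ) :
    (sqProd (d / 2) (k + 1)).comp (X + C (1 / 2)) =
      sqProd ((1 + d) / 2) k * ((X + C ((1 + d) / 2 + k)) * (X + C ((1 - d) / 2))) := by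
  induction k with
  | zero =>
    refine Polynomial.funext fun z => ?_
    simp [sqProd]
    ring
  | succ k ih =>
    rw [sqProd_succ, mul_comp, ih, sqProd_succ]
    refine Polynomial.funext fun z => ?_
    simp only [eval_mul, eval_comp, eval_sub, eval_add, eval_pow, eval_X, eval_C]
    push_cast
    ring

theorem sqProd_comp_X_sub_half (d : ℚ) (k : ℕ) :
    (sqProd (d / 2) (k + 1)).comp (X - C (1 / 2)) =
      sqProd ((1 + d) / 2) k * ((X - C ((1 + d) / 2 + k)) * (X - C ((1 - d) / 2))) := by
  have h := congrArg (fun p : ℚ[X] => p.comp (-X)) (sqProd_comp_X_add_half d k)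
  have h2 : (sqProd (d / 2) (k + 1)).comp (X - C (1 / 2)) =
      ((sqProd (d / 2) (k + 1)).comp (X + C (1 / 2))).comp (-X) := by
    conv_lhs => rw [← sqProd_comp_neg_X]
    rw [comp_assoc, comp_assoc]
    congr 1
    simp only [neg_comp, add_comp, X_comp, C_comp]
    ring
  rw [h2, h]
  simp only [mul_comp, sqProd_comp_neg_X, add_comp, X_comp, C_comp]
  ring

theorem eval_sqProd_self (a : ℚ) (k : ℕ) : (sqProd a (k + 1)).eval a = 0 := by
  rw [sqProd, eval_prod]
  exact Finset.prod_eq_zero (i := 0) (by simp) (by simp)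

theorem eval_sqProd_neg_self (a : ℚ) (k : ℕ) : (sqProd a (k + 1)).eval (-a) = 0 := by
  rw [sqProd, eval_prod]
  exact Finset.prod_eq_zero (i := 0) (by simp) (by simp)

namespace IsEulerDifference

variable {Φ : ℚ[X] →ₗ[ℚ] ℚ} {d : ℚ}

theorem map_comp_neg_X (h : IsEulerDifference Φ d) (g : ℚ[X]) : Φ (g.comp (-X)) = -Φ g := by
  set Ψ : ℚ[X] →ₗ[ℚ] ℚ := Φ ∘ₗ ((aeval (-X : ℚ[X])).toLinearMap + LinearMap.id) with hΨ
  have hΨ' : ∀ p, Ψ p = Φ (p.comp (-X)) + Φ p := fun p => by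
    simp [hΨ, comp_eq_aeval]
  have hz : Ψ ∘ₗ (aeval (X - C (1 / 2) : ℚ[X])).toLinearMap = 0 := by
    refine eq_zero_of_comp_X_add_one _ fun f => ?_
    have key : ∀ p : ℚ[X], (Ψ ∘ₗ (aeval (X - C (1 / 2) : ℚ[X])).toLinearMap) p =
        Ψ (p.comp (X - C (1 / 2))) := fun p => by simp [comp_eq_aeval]
    have hc : (C (1 / 2 : ℚ) : ℚ[X]) + C (1 / 2) = 1 := by rw [← C_add]; norm_num
    have e1 : (f.comp (X + 1) + f).comp (X - C (1 / 2)) =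
        f.comp (X + C (1 / 2)) + f.comp (X - C (1 / 2)) := by
      rw [add_comp, comp_assoc]
      congr 2
      rw [← hc]
      simp only [add_comp, X_comp, C_comp]
      ring
    have e2 : (f.comp (X + C (1 / 2)) + f.comp (X - C (1 / 2))).comp (-X) =
        (f.comp (-X)).comp (X + C (1 / 2)) + (f.comp (-X)).comp (X - C (1 / 2)) := by
      rw [add_comp, comp_assoc, comp_assoc, comp_assoc, comp_assoc, add_comm]
      congr 2 <;> simp only [neg_comp, add_comp, sub_comp, X_comp, C_comp] <;> ring
    rw [key, e1, hΨ', e2, h f, h (f.comp (-X)), eval_comp, eval_comp]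
    simp only [eval_neg, eval_X, neg_div, neg_neg]
    ring
  have := LinearMap.congr_fun hz (g.comp (X + C (1 / 2)))
  have e3 : (g.comp (X + C (1 / 2))).comp (X - C (1 / 2)) = g := by
    rw [comp_assoc]; simp
  rw [LinearMap.comp_apply, AlgHom.toLinearMap_apply, ← comp_eq_aeval, e3, hΨ',
    LinearMap.zero_apply] at this
  linarith

theorem map_even (h : IsEulerDifference Φ d) {g : ℚ[X]} (hg : g.comp (-X) = g) : Φ g = 0 := by
  have := h.map_comp_neg_X g
  rw [hg] at this
  linarith

theorem map_X (h : IsEulerDifference Φ d) : Φ X = -d := by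
  have h1 := h X
  have h2 : (X : ℚ[X]).comp (X + C (1 / 2)) + X.comp (X - C (1 / 2)) = (2 : ℚ) • X := by
    simp only [X_comp, smul_eq_C_mul, map_ofNat]; ring
  rw [h2, map_smul, smul_eq_mul, eval_X, eval_X] at h1
  linarith

theorem map_X_mul_sqProd_succ (h : IsEulerDifference Φ d) (k : ℕ) :
    Φ (X * sqProd ((1 + d) / 2) (k + 1)) =
      -((k + 1) * (1 + d / 2 + k)) * Φ (X * sqProd ((1 + d) / 2) k) := by
  have h1 := h (X * sqProd (d / 2) (k + 1))
  have h2 : (X * sqProd (d / 2) (k + 1)).comp (X + C (1 / 2)) +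
      (X * sqProd (d / 2) (k + 1)).comp (X - C (1 / 2)) =
      (2 : ℚ) • (X * sqProd ((1 + d) / 2) (k + 1)) +
        (2 * ((k + 1) * (1 + d / 2 + k))) • (X * sqProd ((1 + d) / 2) k) := by
    rw [mul_comp, mul_comp, sqProd_comp_X_add_half, sqProd_comp_X_sub_half, sqProd_succ]
    refine Polynomial.funext fun z => ?_
    simp only [X_comp, eval_mul, eval_smul, smul_eq_mul, eval_sub, eval_add, eval_pow, eval_X, eval_C]
    ring
  rw [h2, map_add, map_smul, map_smul, eval_mul, eval_mul, eval_sqProd_self, neg_div,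
    eval_sqProd_neg_self, smul_eq_mul, smul_eq_mul] at h1
  linarith

theorem map_X_mul_sqProd (h : IsEulerDifference Φ d) (k l : ℕ) :
    Φ (X * (sqProd ((1 + d) / 2) k * sqProd ((1 - d) / 2) l)) =
      -d * ((-1) ^ (k + l) * (k + l).factorial * (∏ i ∈ Finset.range k, (1 + d / 2 + i)) *
        ∏ i ∈ Finset.range l, (1 - d / 2 + i)) := by
  induction l generalizing k with
  | zero =>
    induction k with
    | zero => simp [sqProd, h.map_X]
    | succ k ih =>
      simp only [sqProd, Finset.range_zero, Finset.prod_empty, mul_one, add_zero] at ih ⊢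
      have := h.map_X_mul_sqProd_succ k
      simp only [sqProd] at this
      rw [this, ih, Finset.prod_range_succ (fun i : ℕ => 1 + d / 2 + (i : ℚ)),
        Nat.factorial_succ]
      push_cast
      ring
  | succ l ih =>
    have e : X * (sqProd ((1 + d) / 2) k * sqProd ((1 - d) / 2) (l + 1)) =
        X * (sqProd ((1 + d) / 2) (k + 1) * sqProd ((1 - d) / 2) l) +
          (((1 + d) / 2 + k) ^ 2 - ((1 - d) / 2 + l) ^ 2) •
            (X * (sqProd ((1 + d) / 2) k * sqProd ((1 - d) / 2) l)) := by
      rw [sqProd_succ, sqProd_succ, smul_eq_C_mul, C_sub]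
      ring
    rw [e, map_add, map_smul, ih, ih, smul_eq_mul,
      Finset.prod_range_succ (fun i : ℕ => 1 + d / 2 + (i : ℚ)),
      Finset.prod_range_succ (fun i : ℕ => 1 - d / 2 + (i : ℚ)),
      show k + 1 + l = k + l + 1 by ring, show k + (l + 1) = k + l + 1 by ring,
      Nat.factorial_succ]
    push_cast
    ring

end IsEulerDifference

theorem det_choose_eq_one (n : ℕ) :
    (Matrix.of fun i j : Fin (n + 1) => (((i.1 + j.1).choose i.1 : ℕ) : ℚ)).det = 1 := by
  set p := Matrix.of fun i j : Fin (n + 1) => (((X + 1 : ℚ[X]) ^ (j : ℕ)).coeff i) with hp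
  have hmon : (X + 1 : ℚ[X]).Monic := by simpa using monic_X_add_C (1 : ℚ)
  have hdet : p.det = 1 := by
    refine Matrix.det_matrixOfPolynomials (fun i : Fin (n + 1) => (X + 1 : ℚ[X]) ^ (i : ℕ))
      (fun i => ?_) fun i => hmon.pow _
    rw [hmon.natDegree_pow, show (X + 1 : ℚ[X]) = X + C 1 by simp, natDegree_X_add_C, mul_one]
  have : (Matrix.of fun i j : Fin (n + 1) => (((i.1 + j.1).choose i.1 : ℕ) : ℚ)) =
      p.transpose * p := by
    ext i j
    simp only [hp, Matrix.mul_apply, Matrix.transpose_apply, Matrix.of_apply, coeff_X_add_one_pow]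
    rw [Fin.sum_univ_eq_sum_range (fun k => (((i : ℕ).choose k : ℕ) : ℚ) * ((j : ℕ).choose k : ℕ)),
      Nat.add_choose_eq, Finset.Nat.sum_antidiagonal_eq_sum_range_succ_mk]
    push_cast
    rw [← Finset.sum_range_reflect,
      ← Finset.sum_subset (Finset.range_subset_range.2 i.2)
        fun k _ hk => by
          rw [Nat.choose_eq_zero_of_lt (not_lt.1 fun h => hk (Finset.mem_range.2 h)),
            Nat.cast_zero, zero_mul]]
    refine Finset.sum_congr rfl fun k hk => ?_
    have hk' : k ≤ i := Nat.lt_succ_iff.1 (Finset.mem_range.1 hk)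
    rw [show (i : ℕ) + 1 - 1 - k = i - k by omega, Nat.choose_symm hk',
      show (i : ℕ) - (i - k) = k by omega]
  rw [this, Matrix.det_mul, Matrix.det_transpose, hdet, one_mul]

theorem hankel_eq_zero_of_even_eq_zero (c : ℕ → ℚ) (hc : ∀ k, Even k → c k = 0) (m : ℕ) :
    hankel c (2 * m) = 0 := by
  set M := Matrix.of fun i j : Fin (2 * m + 1) => c (i.1 + j.1) with hM
  have h1 := Matrix.det_mul_column (fun i : Fin (2 * m + 1) => (-1 : ℚ) ^ (i : ℕ))
    (Matrix.of fun i j => (-1 : ℚ) ^ (j : ℕ) * M i j)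
  rw [Matrix.det_mul_row (fun i : Fin (2 * m + 1) => (-1 : ℚ) ^ (i : ℕ)), ← mul_assoc,
    ← Finset.prod_mul_distrib, Finset.prod_eq_one fun i _ => by
      rw [← mul_pow]; norm_num, one_mul] at h1
  have h2 : (Matrix.of fun i j : Fin (2 * m + 1) =>
      (-1 : ℚ) ^ (i : ℕ) * (Matrix.of fun i j : Fin (2 * m + 1) => (-1 : ℚ) ^ (j : ℕ) * M i j) i j)
      = -M := by
    ext i j
    simp only [hM, Matrix.of_apply, Matrix.neg_apply]
    rw [← mul_assoc, ← pow_add]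
    rcases Nat.even_or_odd (i.1 + j.1) with h | h
    · rw [hc _ h]; simp
    · rw [h.neg_one_pow]; ring
  rw [h2, Matrix.det_neg, Fintype.card_fin, (odd_two_mul_add_one m).neg_one_pow] at h1
  change M.det = 0
  linarith

theorem prod_Icc_pow_eq_prod_range_prod_range (g : ℕ → ℚ) (m : ℕ) :
    ∏ ℓ ∈ Finset.Icc 1 m, g ℓ ^ (2 * (m + 1 - ℓ)) =
      (∏ i ∈ Finset.range (m + 1), ∏ ℓ ∈ Finset.range i, g (ℓ + 1)) ^ 2 := by
  induction m with
  | zero => simp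
  | succ m ih =>
    have hI : ∏ ℓ ∈ Finset.range (m + 1), g (ℓ + 1) = ∏ ℓ ∈ Finset.Icc 1 (m + 1), g ℓ := by
      rw [Finset.range_eq_Ico, Finset.prod_Ico_add' g 0 (m + 1) 1]
      rfl
    rw [Finset.prod_range_succ, mul_pow, ← ih, hI, Finset.prod_Icc_succ_top (by omega),
      Finset.prod_Icc_succ_top (by omega), mul_pow, ← Finset.prod_pow, ← mul_assoc,
      ← Finset.prod_mul_distrib]
    congr 1
    · refine Finset.prod_congr rfl fun ℓ hℓ => ?_
      rw [← pow_add]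
      congr 1
      have := (Finset.mem_Icc.1 hℓ).2
      omega
    · congr 1
      omega

namespace IsEulerDifference

variable {Φ : ℚ[X] →ₗ[ℚ] ℚ} {d : ℚ}

theorem det_map_X_mul_sqProd (h : IsEulerDifference Φ d) (m : ℕ) :
    (Matrix.of fun i j : Fin (m + 1) =>
      Φ (X * (sqProd ((1 + d) / 2) i * sqProd ((1 - d) / 2) j))).det =
      (-d) ^ (m + 1) * ∏ i ∈ Finset.range (m + 1), ∏ ℓ ∈ Finset.range i,
        -(((ℓ + 1 : ℕ) : ℚ) ^ 2 / 4 * (d ^ 2 - (2 * ((ℓ + 1 : ℕ) : ℚ)) ^ 2)) := by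
  set u : Fin (m + 1) → ℚ := fun i => -d * ((-1) ^ (i : ℕ) * (i : ℕ).factorial *
    ∏ t ∈ Finset.range i, (1 + d / 2 + t)) with hu
  set v : Fin (m + 1) → ℚ := fun i => (-1) ^ (i : ℕ) * (i : ℕ).factorial *
    ∏ t ∈ Finset.range i, (1 - d / 2 + t) with hv
  have hM : (Matrix.of fun i j : Fin (m + 1) =>
      Φ (X * (sqProd ((1 + d) / 2) i * sqProd ((1 - d) / 2) j))) =
      Matrix.of fun i j => u i * (Matrix.of fun i j => v j *
        (Matrix.of fun i j : Fin (m + 1) => (((i.1 + j.1).choose i.1 : ℕ) : ℚ)) i j) i j := by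
    ext i j
    have hf : ((i.1 + j.1).factorial : ℚ) =
        ((i.1 + j.1).choose i.1 : ℕ) * (i.1.factorial * j.1.factorial) := by
      rw [← Nat.add_choose_mul_factorial_mul_factorial i.1 j.1, Nat.choose_symm_add]
      push_cast
      rw [mul_assoc]
    simp only [Matrix.of_apply, h.map_X_mul_sqProd, hf, hu, hv]
    ring
  rw [hM, Matrix.det_mul_column, Matrix.det_mul_row, det_choose_eq_one, mul_one,
    ← Finset.prod_mul_distrib]
  have hfac : ∀ n : ℕ, (n.factorial : ℚ) = ∏ ℓ ∈ Finset.range n, ((ℓ + 1 : ℕ) : ℚ) := fun n => by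
    rw [← Finset.prod_range_add_one_eq_factorial]; push_cast; rfl
  rw [← Fin.prod_univ_eq_prod_range (fun i => ∏ ℓ ∈ Finset.range i,
    -(((ℓ + 1 : ℕ) : ℚ) ^ 2 / 4 * (d ^ 2 - (2 * ((ℓ + 1 : ℕ) : ℚ)) ^ 2))),
    show (-d) ^ (m + 1) = ∏ _i : Fin (m + 1), -d by simp, ← Finset.prod_mul_distrib]
  refine Finset.prod_congr rfl fun i _ => ?_
  have hs : ((-1 : ℚ) ^ (i : ℕ)) * (-1) ^ (i : ℕ) = 1 := by rw [← mul_pow]; norm_num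
  have : ∏ ℓ ∈ Finset.range i,
      -(((ℓ + 1 : ℕ) : ℚ) ^ 2 / 4 * (d ^ 2 - (2 * ((ℓ + 1 : ℕ) : ℚ)) ^ 2)) =
      ((i : ℕ).factorial * ∏ t ∈ Finset.range i, (1 + d / 2 + (t : ℚ))) *
        ((i : ℕ).factorial * ∏ t ∈ Finset.range i, (1 - d / 2 + (t : ℚ))) := by
    rw [hfac, ← Finset.prod_mul_distrib, ← Finset.prod_mul_distrib, ← Finset.prod_mul_distrib]
    refine Finset.prod_congr rfl fun ℓ _ => ?_
    push_cast
    ring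
  rw [this]
  simp only [hu, hv]
  linear_combination (-d * ((i : ℕ).factorial * ∏ t ∈ Finset.range i, (1 + d / 2 + (t : ℚ))) *
        ((i : ℕ).factorial * ∏ t ∈ Finset.range i, (1 - d / 2 + (t : ℚ)))) * hs

theorem hankel_even (h : IsEulerDifference Φ d) (m : ℕ) :
    hankel (fun k => Φ (X ^ k)) (2 * m) = 0 :=
  hankel_eq_zero_of_even_eq_zero _ (fun k hk => h.map_even (by
    rw [X_pow_comp, hk.neg_pow])) m

theorem hankel_odd (h : IsEulerDifference Φ d) (m : ℕ) :
    hankel (fun k => Φ (X ^ k)) (2 * m + 1) =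
      (-1) ^ (m + 1) * (Matrix.of fun i j : Fin (m + 1) =>
        Φ (X * (sqProd ((1 + d) / 2) i * sqProd ((1 - d) / 2) j))).det ^ 2 := by
  set N := Matrix.of fun i j : Fin (m + 1) =>
    Φ (X * (sqProd ((1 + d) / 2) i * sqProd ((1 - d) / 2) j)) with hN
  have hmon : ∀ (a : ℚ) (i : ℕ), (X ^ (i % 2) * sqProd a (i / 2)).Monic := fun a i =>
    (monic_X_pow _).mul (monic_sqProd _ _)
  have hdeg : ∀ (a : ℚ) (i : ℕ), (X ^ (i % 2) * sqProd a (i / 2)).natDegree = i := fun a i => by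
    rw [(monic_X_pow _).natDegree_mul (monic_sqProd _ _), natDegree_X_pow, natDegree_sqProd]
    omega
  rw [← det_monic_eq_hankel Φ _ _ _ (hmon ((1 + d) / 2)) (hdeg _) (hmon ((1 - d) / 2)) (hdeg _)]
  set e : Fin (m + 1) × Fin 2 ≃ Fin (2 * m + 1 + 1) :=
    finProdFinEquiv.trans (finCongr (by ring)) with he
  have hval : ∀ p, ((e p : Fin (2 * m + 1 + 1)) : ℕ) = p.2 + 2 * p.1 := fun p => by
    simp [he, finProdFinEquiv]
  have hdiv : ∀ p, ((e p : Fin (2 * m + 1 + 1)) : ℕ) / 2 = p.1 := fun p => by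
    rw [hval]; omega
  have hmod : ∀ p, ((e p : Fin (2 * m + 1 + 1)) : ℕ) % 2 = p.2 := fun p => by
    rw [hval]; omega
  rw [← Matrix.det_submatrix_equiv_self e]
  have hK : (Matrix.of fun i j : Fin (2 * m + 1 + 1) =>
      Φ (X ^ (i.1 % 2) * sqProd ((1 + d) / 2) (i.1 / 2) *
        (X ^ (j.1 % 2) * sqProd ((1 - d) / 2) (j.1 / 2)))).submatrix e e =
      Matrix.kroneckerMap (· * ·) N !![0, 1; 1, 0] := by
    ext ⟨i, a⟩ ⟨j, b⟩
    simp only [Matrix.submatrix_apply, Matrix.of_apply, hdiv, hmod, Matrix.kroneckerMap_apply, hN]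
    have hev : ∀ k, Even k →
        Φ (X ^ k * (sqProd ((1 + d) / 2) i * sqProd ((1 - d) / 2) j)) = 0 := fun k hk =>
      h.map_even (by
        rw [mul_comp, mul_comp, sqProd_comp_neg_X, sqProd_comp_neg_X, X_pow_comp, hk.neg_pow])
    rw [mul_mul_mul_comm, ← pow_add]
    fin_cases a <;> fin_cases b
    · simpa using hev 0 (by decide)
    · simp
    · simp
    · simpa using hev 2 (by decide)
  rw [hK, Matrix.det_kronecker, Matrix.det_fin_two_of]
  simp only [Fintype.card_fin]
  norm_num
  ring

end IsEulerDifference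

theorem isEulerDifference_momentFunctional (y d : ℚ) :
    IsEulerDifference (momentFunctional (fun k => eulerPoly k y - eulerPoly k (y + d)) ∘ₗ
      (aeval (X - C (y + d / 2 - 1 / 2) : ℚ[X])).toLinearMap) d := by
  intro g
  have hsub : momentFunctional (fun k => eulerPoly k y - eulerPoly k (y + d)) =
      momentFunctional (fun k => eulerPoly k y) -
        momentFunctional (fun k => eulerPoly k (y + d)) :=
    linearMap_ext_X_pow fun n => by simp [momentFunctional_X_pow]
  have hcomp : (g.comp (X + C (1 / 2)) + g.comp (X - C (1 / 2))).comp
        (X - C (y + d / 2 - 1 / 2)) =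
      (g.comp (X - C (y + d / 2))).comp (X + 1) + g.comp (X - C (y + d / 2)) := by
    refine Polynomial.funext fun z => ?_
    simp only [eval_add, eval_comp, eval_sub, eval_X, eval_C, eval_one]
    congr 2 <;> ring
  rw [LinearMap.comp_apply, AlgHom.toLinearMap_apply, ← comp_eq_aeval, hcomp, hsub,
    LinearMap.sub_apply, momentFunctional_eulerPoly, momentFunctional_eulerPoly, eval_comp,
    eval_comp]
  simp only [eval_sub, eval_X, eval_C]
  rw [show y - (y + d / 2) = -d / 2 by ring, show y + d - (y + d / 2) = d / 2 by ring]
  ring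

theorem hankel_comp_X_sub_C (c : ℕ → ℚ) (t : ℚ) (n : ℕ) :
    hankel (fun k => (momentFunctional c ∘ₗ (aeval (X - C t : ℚ[X])).toLinearMap) (X ^ k)) n =
      hankel c n := by
  have hmon : ∀ i : ℕ, ((X - C t : ℚ[X]) ^ i).Monic := fun i => (monic_X_sub_C t).pow i
  have hdeg : ∀ i : ℕ, ((X - C t : ℚ[X]) ^ i).natDegree = i := fun i => by simp
  have := det_monic_eq_hankel (momentFunctional c) n _ _ hmon hdeg hmon hdeg
  simp only [momentFunctional_X_pow] at this
  rw [← this, hankel]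
  simp [pow_add]

theorem hankel_euler_diff (q r s : ℕ) (hq : 1 ≤ q) (hrs : r < s) (x : ℚ) (m : ℕ) :
    hankel (fun k => eulerPoly k ((x + r) / q) - eulerPoly k ((x + s) / q)) (2 * m) = 0 ∧
    hankel (fun k => eulerPoly k ((x + r) / q) - eulerPoly k ((x + s) / q)) (2 * m + 1)
      = (-1 : ℚ) ^ (m + 1) * (((s : ℚ) - r) / q) ^ (2 * m + 2) *
        ∏ ℓ ∈ Finset.Icc 1 m,
          (((ℓ : ℚ) ^ 2 / 4) * ((((s : ℚ) - r) / q) ^ 2 - (2 * (ℓ : ℚ)) ^ 2))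
            ^ (2 * (m + 1 - ℓ)) := by
  have hq0 : (q : ℚ) ≠ 0 := Nat.cast_ne_zero.2 (by omega)
  set d : ℚ := ((s : ℚ) - r) / q with hd
  have hs : (x + s) / q = (x + r) / q + d := by
    rw [hd]; field_simp; ring
  simp only [hs]
  have h := isEulerDifference_momentFunctional ((x + r) / q) d
  rw [← hankel_comp_X_sub_C _ ((x + r) / q + d / 2 - 1 / 2) (2 * m),
    ← hankel_comp_X_sub_C _ ((x + r) / q + d / 2 - 1 / 2) (2 * m + 1)]
  refine ⟨h.hankel_even m, ?_⟩
  rw [h.hankel_odd, h.det_map_X_mul_sqProd, prod_Icc_pow_eq_prod_range_prod_range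
    (fun ℓ => ((ℓ : ℚ) ^ 2 / 4) * (d ^ 2 - (2 * (ℓ : ℚ)) ^ 2))]
  have hsign : ∀ f : ℕ → ℚ, (∏ i ∈ Finset.range (m + 1), ∏ ℓ ∈ Finset.range i, -f ℓ) ^ 2 =
      (∏ i ∈ Finset.range (m + 1), ∏ ℓ ∈ Finset.range i, f ℓ) ^ 2 := fun f => by
    simp only [← Finset.prod_pow, neg_sq]
  rw [mul_pow, hsign, ← pow_mul, mul_comm (m + 1) 2, (even_two_mul (m + 1)).neg_pow, mul_assoc,
    mul_add_one]
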